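/- For every integer k ≥ 1, every directed graph G on a finite vertex set V, and every designated source s ∈ V, there exists a subgraph H of G such that (i) every vertex of V has in-degree at most 2^k in H (hence H has at most 2^k·|V| edges), and (ii) H is a k-FTRS of G with respect to s. -/

import Mathlib

/-- `v` is reachable from `u` in the directed graph with edge set `E`
(via a directed path, possibly of length 0). -/
def DReach {V : Type*} (E : Set (V × V)) (u v : V) : Prop :=
  Relation.ReflTransGen (fun a b => (a, b) ∈ E) u v

/-- `H` is a `k`-fault-tolerant reachability subgraph (`k`-FTRS) of the graph
with edge set `E` with respect to the source `s`. -/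
def IsKFTRS {V : Type*} (k : ℕ) (E H : Set (V × V)) (s : V) : Prop :=
  H ⊆ E ∧ ∀ F : Finset (V × V), ↑F ⊆ E → F.card ≤ k →
    ∀ v : V, DReach (E \ ↑F) s v ↔ DReach (H \ ↑F) s v

section Cuts

variable {W : Type*} [DecidableEq W]

/-- The edges of `D` that leave the vertex set `A`. -/
def outCut (D : Finset (W × W)) (A : Finset W) : Finset (W × W) :=
  D.filter (fun e => e.1 ∈ A ∧ e.2 ∉ A)

theorem mem_outCut {D : Finset (W × W)} {A : Finset W} {e : W × W} :
    e ∈ outCut D A ↔ e ∈ D ∧ e.1 ∈ A ∧ e.2 ∉ A := by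
  simp [outCut]

theorem outCut_mono {D D' : Finset (W × W)} (h : D ⊆ D') (A : Finset W) :
    outCut D A ⊆ outCut D' A :=
  Finset.filter_subset_filter _ h

theorem card_outCut_union_add_card_outCut_inter_le (D : Finset (W × W)) (A B : Finset W) :
    (outCut D (A ∪ B)).card + (outCut D (A ∩ B)).card ≤
      (outCut D A).card + (outCut D B).card := by
  simp only [outCut, Finset.card_filter, ← Finset.sum_add_distrib]
  refine Finset.sum_le_sum fun e _ => ?_
  simp only [Finset.mem_union, Finset.mem_inter]
  by_cases h1 : e.1 ∈ A <;> by_cases h2 : e.1 ∈ B <;> by_cases h3 : e.2 ∈ A <;>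
    by_cases h4 : e.2 ∈ B <;> simp [h1, h2, h3, h4]

/-- Among the minimum cuts separating `X` from `t` there is one whose source side contains the
source sides of all others. -/
theorem exists_farthest_min_cut [Fintype W] (D : Finset (W × W)) {X : Finset W} {t : W}
    (ht : t ∉ X) :
    ∃ A : Finset W, X ⊆ A ∧ t ∉ A ∧ ∀ R : Finset W, X ⊆ R → t ∉ R →
      (outCut D A).card ≤ (outCut D R).card ∧
        ((outCut D R).card ≤ (outCut D A).card → R ⊆ A) := by
  obtain ⟨B, hB, hBmin⟩ := Finset.exists_min_image
    (Finset.univ.filter fun A : Finset W => X ⊆ A ∧ t ∉ A) (fun A => (outCut D A).card)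
    ⟨X, by simpa using ht⟩
  simp only [Finset.mem_filter, Finset.mem_univ, true_and, and_imp] at hB hBmin
  obtain ⟨A, hA, hAmax⟩ := Finset.exists_max_image
    (Finset.univ.filter fun A : Finset W =>
      X ⊆ A ∧ t ∉ A ∧ (outCut D A).card ≤ (outCut D B).card) Finset.card
    ⟨B, by simpa using hB⟩
  simp only [Finset.mem_filter, Finset.mem_univ, true_and, and_imp] at hA hAmax
  obtain ⟨hXA, htA, hAB⟩ := hA
  refine ⟨A, hXA, htA, fun R hXR htR => ⟨hAB.trans (hBmin R hXR htR), fun hRA => ?_⟩⟩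
  have hsub := card_outCut_union_add_card_outCut_inter_le D A R
  have hinter := hBmin (A ∩ R) (Finset.subset_inter hXA hXR) (by simp [htA])
  have hcard := hAmax (A ∪ R) (hXA.trans Finset.subset_union_left) (by simp [htA, htR]) (by omega)
  have heq := Finset.eq_of_subset_of_card_le Finset.subset_union_left hcard
  rw [heq]
  exact Finset.subset_union_right

/-- Adding to `A` the out-neighbours of `A` other than `t` at most doubles the cut when all
out-degrees are at most two. -/
theorem card_outCut_expand_le [Fintype W] {D : Finset (W × W)}
    (hdeg : ∀ a, (D.filter fun e => e.1 = a).card ≤ 2) (t : W) (A : Finset W) :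
    (outCut D (A ∪ Finset.univ.filter fun b => b ≠ t ∧ ∃ a ∈ A, (a, b) ∈ D)).card ≤
      2 * (outCut D A).card := by
  set C := outCut D A with hC
  have hsub : outCut D (A ∪ Finset.univ.filter fun b => b ≠ t ∧ ∃ a ∈ A, (a, b) ∈ D) ⊆
      C.filter (fun e => e.2 = t) ∪
        (C.filter fun e => ¬ e.2 = t).biUnion fun e => D.filter fun e' => e'.1 = e.2 := by
    rintro ⟨a, b⟩ h
    simp only [mem_outCut, Finset.mem_union, Finset.mem_filter, Finset.mem_univ, true_and,
      Finset.mem_biUnion, Prod.exists, hC] at h ⊢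
    obtain ⟨hD, ha, hb⟩ := h
    push Not at hb
    by_cases haA : a ∈ A
    · left
      refine ⟨⟨hD, haA, hb.1⟩, ?_⟩
      by_contra hbt
      exact hb.2 hbt a haA hD
    · right
      obtain ⟨hat, a', ha', hD'⟩ := ha.resolve_left haA
      exact ⟨a', a, ⟨⟨hD', ha', haA⟩, hat⟩, hD, rfl⟩
  have h1 := (Finset.card_le_card hsub).trans (Finset.card_union_le _ _)
  have h2 := Finset.card_biUnion_le_card_mul (C.filter fun e => ¬ e.2 = t)
    (fun e => D.filter fun e' => e'.1 = e.2) 2 (fun e _ => hdeg e.2)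
  have h3 := Finset.card_filter_add_card_filter_not (s := C) (fun e => e.2 = t)
  omega

/-- The nested source set of the construction: it can be cut from `t` by `2 ^ k` edges, and every
connected set around `s` that sees `t` and leaves `S` meets `S` in a set that cannot be cut
from `t` by `k` edges. -/
theorem exists_source_set [Fintype W] {D : Finset (W × W)} {s t : W} (hst : s ≠ t)
    (hs : (D.filter fun e => e.1 = s).card ≤ 1)
    (hdeg : ∀ a, (D.filter fun e => e.1 = a).card ≤ 2) (k : ℕ) :
    ∃ S : Finset W, s ∈ S ∧ t ∉ S ∧
      (∃ A, S ⊆ A ∧ t ∉ A ∧ (outCut D A).card ≤ 2 ^ k) ∧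
      ∀ R : Finset W, s ∈ R → t ∉ R → (∃ u ∈ R, (u, t) ∈ D) →
        (∀ A : Finset W, s ∈ A → ¬ R ⊆ A → ∃ a b, (a, b) ∈ D ∧ a ∈ A ∧ b ∈ R ∧ b ∉ A) →
        ¬ R ⊆ S → ∀ Q : Finset W, R ∩ S ⊆ Q → t ∉ Q → k + 1 ≤ (outCut D Q).card := by
  induction k with
  | zero =>
    refine ⟨{s}, by simp, by simpa using hst.symm, ⟨{s}, subset_rfl, by simpa using hst.symm, ?_⟩,
      fun R hsR htR hu hconn _ Q hQ htQ => ?_⟩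
    · refine (Finset.card_le_card fun e he => ?_).trans hs
      rw [mem_outCut] at he
      exact Finset.mem_filter.2 ⟨he.1, Finset.mem_singleton.1 he.2.1⟩
    · have hsQ : s ∈ Q := hQ (by simp [hsR])
      rw [zero_add, Nat.succ_le_iff, Finset.card_pos]
      by_cases hRQ : R ⊆ Q
      · obtain ⟨u, huR, huD⟩ := hu
        exact ⟨(u, t), mem_outCut.2 ⟨huD, hRQ huR, htQ⟩⟩
      · obtain ⟨a, b, hD, ha, -, hb⟩ := hconn Q hsQ hRQ
        exact ⟨(a, b), mem_outCut.2 ⟨hD, ha, hb⟩⟩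
  | succ k ih =>
    obtain ⟨S, hsS, htS, ⟨A₀, hSA₀, htA₀, hA₀⟩, hS⟩ := ih
    obtain ⟨A, hSA, htA, hA⟩ := exists_farthest_min_cut D htS
    set S' := A ∪ Finset.univ.filter fun b => b ≠ t ∧ ∃ a ∈ A, (a, b) ∈ D with hS'
    have htS' : t ∉ S' := by simp [hS', htA]
    have hAS' : A ⊆ S' := Finset.subset_union_left
    have hcard : (outCut D S').card ≤ 2 ^ (k + 1) := by
      have h1 : (outCut D S').card ≤ _ := card_outCut_expand_le hdeg t A
      have h2 := (hA A₀ hSA₀ htA₀).1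
      rw [pow_succ]
      omega
    refine ⟨S', hAS' (hSA hsS), htS', ⟨S', subset_rfl, htS', hcard⟩,
      fun R hsR htR hu hconn hRS' Q hQ htQ => ?_⟩
    obtain ⟨a, b, hD, ha, hbR, hbA⟩ := hconn A (hSA hsS) fun h => hRS' (h.trans hAS')
    have hbS' : b ∈ S' := by
      have hbt : b ≠ t := fun h => htR (h ▸ hbR)
      simp only [hS', Finset.mem_union, Finset.mem_filter, Finset.mem_univ, true_and]
      exact Or.inr ⟨hbt, a, ha, hD⟩
    have hbQ : b ∈ Q := hQ (Finset.mem_inter.2 ⟨hbR, hbS'⟩)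
    have hinter := hS R hsR htR hu hconn (fun h => hRS' (h.trans (hSA.trans hAS'))) (Q ∩ A)
      (Finset.subset_inter ((Finset.inter_subset_inter_left (hSA.trans hAS')).trans hQ)
        (Finset.inter_subset_right.trans hSA)) (by simp [htA])
    have hunion : (outCut D A).card < (outCut D (Q ∪ A)).card := by
      by_contra! h
      exact hbA ((hA (Q ∪ A) (hSA.trans Finset.subset_union_right) (by simp [htQ, htA])).2 h
        (Finset.mem_union_left _ hbQ))
    have hsub := card_outCut_union_add_card_outCut_inter_le D Q A
    omega

/-- The edges into `t` can be thinned out to at most the size of a minimum cut between `S` and `t`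
without making any cut between `S` and `t` smaller than that minimum. -/
theorem exists_thinned_in_edges [Fintype W] (D : Finset (W × W)) {S : Finset W} {t : W}
    (n : ℕ) (hn : ∀ Q, S ⊆ Q → t ∉ Q → n ≤ (outCut D Q).card)
    (B : Finset W) (hSB : S ⊆ B) (htB : t ∉ B) (hB : (outCut D B).card ≤ n) :
    ∃ H ⊆ D, (∀ e ∈ D, e.2 ≠ t → e ∈ H) ∧ (H.filter fun e => e.2 = t).card ≤ n ∧
      ∀ Q, S ⊆ Q → t ∉ Q → n ≤ (outCut H Q).card := by
  obtain ⟨H, hH, hHmin⟩ := Finset.exists_min_image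
    (D.powerset.filter fun H => (∀ e ∈ D, e.2 ≠ t → e ∈ H) ∧
      ∀ Q, S ⊆ Q → t ∉ Q → n ≤ (outCut H Q).card) Finset.card
    ⟨D, by simp +contextual [hn]⟩
  simp only [Finset.mem_filter, Finset.mem_powerset, and_imp] at hH hHmin
  obtain ⟨hHD, hkeep, hHn⟩ := hH
  refine ⟨H, hHD, hkeep, ?_, hHn⟩
  obtain ⟨A, hSA, htA, hA⟩ := exists_farthest_min_cut H fun h => htB (hSB h)
  have hAn : (outCut H A).card ≤ n :=
    ((hA B hSB htB).1.trans (Finset.card_le_card (outCut_mono hHD B))).trans hB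
  refine (Finset.card_le_card fun e he => ?_).trans hAn
  rw [Finset.mem_filter] at he
  obtain ⟨heH, het⟩ := he
  have hsmall : ∃ Q, S ⊆ Q ∧ t ∉ Q ∧ (outCut (H.erase e) Q).card < n := by
    by_contra! h
    have h1 := hHmin (H.erase e) ((Finset.erase_subset _ _).trans hHD)
      (fun e' he' het' => Finset.mem_erase.2
        ⟨fun h => het' (h ▸ het), hkeep e' he' het'⟩) h
    have h2 := Finset.card_erase_lt_of_mem heH
    omega
  obtain ⟨Q, hSQ, htQ, hQ⟩ := hsmall
  have heq : outCut (H.erase e) Q = (outCut H Q).erase e := by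
    ext x
    simp only [mem_outCut, Finset.mem_erase]
    tauto
  rw [heq] at hQ
  have heQ : e ∈ outCut H Q := by
    by_contra h
    rw [Finset.erase_eq_of_notMem h] at hQ
    exact absurd (hHn Q hSQ htQ) (by omega)
  rw [Finset.card_erase_of_mem heQ] at hQ
  have hQA := (hA Q hSQ htQ).2 (by have := hHn A hSA htA; omega)
  exact mem_outCut.2 ⟨heH, hQA (mem_outCut.1 heQ).2.1, het ▸ htA⟩

end Cuts

/-- If `v` is reachable from `a` but lies outside a set containing `a`, some edge leaves the set. -/
theorem DReach.exists_edge_leaving {V : Type*} {E : Set (V × V)} {a v : V} (h : DReach E a v)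
    (P : V → Prop) (ha : P a) (hv : ¬ P v) : ∃ x y, (x, y) ∈ E ∧ DReach E a x ∧ P x ∧ ¬ P y := by
  induction h with
  | refl => exact absurd ha hv
  | @tail b c hab hbc ih =>
    by_cases hb : P b
    · exact ⟨b, c, hbc, hab, hb, hv⟩
    · exact ih hb

/-- Thinning the in-edges of a single vertex `t` when out-degrees are at most two and the source
has out-degree at most one. -/
theorem exists_thinned_of_outdegree_le_two {W : Type*} [Fintype W] [DecidableEq W]
    {D : Finset (W × W)} {s t : W} (hst : s ≠ t)
    (hs : (D.filter fun e => e.1 = s).card ≤ 1)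
    (hdeg : ∀ a, (D.filter fun e => e.1 = a).card ≤ 2) (k : ℕ) :
    ∃ H ⊆ D, (∀ e ∈ D, e.2 ≠ t → e ∈ H) ∧ (H.filter fun e => e.2 = t).card ≤ 2 ^ k ∧
      ∀ F : Finset (W × W), F.card ≤ k →
        DReach ((D : Set (W × W)) \ F) s t → DReach ((H : Set (W × W)) \ F) s t := by
  classical
  obtain ⟨S, hsS, htS, ⟨A₀, hSA₀, htA₀, hA₀⟩, hS⟩ := exists_source_set hst hs hdeg k
  obtain ⟨B, hSB, htB, hB⟩ := exists_farthest_min_cut D htS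
  obtain ⟨H, hHD, hkeep, hHcard, hHn⟩ := exists_thinned_in_edges D (outCut D B).card
    (fun Q h1 h2 => (hB Q h1 h2).1) B hSB htB le_rfl
  refine ⟨H, hHD, hkeep, hHcard.trans ((hB A₀ hSA₀ htA₀).1.trans hA₀), fun F hF hreach => ?_⟩
  by_contra hnot
  set R : Finset W := Finset.univ.filter fun v => DReach ((H : Set (W × W)) \ F) s v with hR
  have memR : ∀ v, v ∈ R ↔ DReach ((H : Set (W × W)) \ F) s v := by simp [hR]
  have hsR : s ∈ R := (memR s).2 .refl
  have htR : t ∉ R := fun h => hnot ((memR t).1 h)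
  have hstep : ∀ a b, a ∈ R → (a, b) ∈ H → (a, b) ∉ F → b ∈ R := fun a b ha h1 h2 =>
    (memR b).2 (((memR a).1 ha).tail ⟨by simpa using h1, by simpa using h2⟩)
  have hRF : (outCut H R).card ≤ k := by
    refine (Finset.card_le_card fun e he => ?_).trans hF
    rw [mem_outCut] at he
    by_contra h
    exact he.2.2 (hstep e.1 e.2 he.2.1 he.1 h)
  obtain ⟨u, w, huw, -, huR, hwR⟩ := hreach.exists_edge_leaving (· ∈ R) hsR htR
  simp only [Set.mem_sdiff, Finset.mem_coe] at huw
  have huwH : (u, w) ∉ H := fun h => hwR (hstep u w huR h huw.2)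
  obtain rfl : w = t := by
    by_contra h
    exact huwH (hkeep _ huw.1 h)
  have hcutB : outCut H B = outCut D B :=
    Finset.eq_of_subset_of_card_le (outCut_mono hHD B) (hHn B hSB htB)
  have hBkeep : ∀ x ∈ B, ∀ y, (x, y) ∈ D → (x, y) ∈ H := fun x hx y hxy => by
    by_cases hy : y = w
    · have : (x, y) ∈ outCut D B := mem_outCut.2 ⟨hxy, hx, hy ▸ htB⟩
      rw [← hcutB] at this
      exact (mem_outCut.1 this).1
    · exact hkeep _ hxy hy
  have huS : u ∉ S := fun h => huwH (hBkeep u (hSB h) w huw.1)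
  have hconn : ∀ A : Finset W, s ∈ A → ¬ R ⊆ A →
      ∃ a b, (a, b) ∈ D ∧ a ∈ A ∧ b ∈ R ∧ b ∉ A := fun A hsA hRA => by
    obtain ⟨v, hvR, hvA⟩ := Finset.not_subset.1 hRA
    obtain ⟨x, y, hxy, hx, hxA, hyA⟩ :=
      ((memR v).1 hvR).exists_edge_leaving (· ∈ A) hsA hvA
    exact ⟨x, y, hHD (by simpa using hxy.1), hxA, (memR y).2 (hx.tail hxy), hyA⟩
  have hlow := hS R hsR htR ⟨u, huR, huw.1⟩ hconn (fun h => huS (h huR)) (R ∩ B)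
    (Finset.inter_subset_inter_left hSB) (by simp [htB])
  have hcutRB : (outCut D (R ∩ B)).card ≤ (outCut H (R ∩ B)).card := by
    refine Finset.card_le_card fun e he => ?_
    rw [mem_outCut] at he ⊢
    exact ⟨hBkeep e.1 (Finset.mem_inter.1 he.2.1).2 e.2 he.1, he.2⟩
  have hsub := card_outCut_union_add_card_outCut_inter_le H R B
  have hunion := hHn (R ∪ B) (hSB.trans Finset.subset_union_right) (by simp [htR, htB])
  rw [hcutB] at hsub
  omega

section Splitting

variable {V : Type*} {n : ℕ}

/-- The copy of the edge `e` in the graph where each vertex `u` is replaced by a path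
`(u, 0), …, (u, n)` whose `(i + 1)`-st vertex carries the edge from `u` to the vertex number `i`. -/
def splitEdge (φ : V ≃ Fin n) (e : V × V) : (V × Fin (n + 1)) × (V × Fin (n + 1)) :=
  ((e.1, (φ e.2).succ), (e.2, 0))

theorem splitEdge_injective (φ : V ≃ Fin n) : Function.Injective (splitEdge φ) := by
  rintro ⟨a, b⟩ ⟨c, d⟩ h
  simp only [splitEdge, Prod.mk.injEq] at h
  exact Prod.ext h.1.1 h.2.1

variable [Fintype V] [DecidableEq V]

/-- The edges of the graph obtained from `E` by replacing each vertex by a path. -/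
def splitGraph (φ : V ≃ Fin n) (E : Finset (V × V)) :
    Finset ((V × Fin (n + 1)) × (V × Fin (n + 1))) :=
  (Finset.univ.filter fun e => e.1.1 = e.2.1 ∧ e.2.2.val = e.1.2.val + 1) ∪ E.image (splitEdge φ)

theorem mem_splitGraph {φ : V ≃ Fin n} {E : Finset (V × V)} {u v : V} {i j : Fin (n + 1)} :
    ((u, i), (v, j)) ∈ splitGraph φ E ↔
      (u = v ∧ j.val = i.val + 1) ∨ ((u, v) ∈ E ∧ i = (φ v).succ ∧ j = 0) := by
  simp only [splitGraph, Finset.mem_union, Finset.mem_filter, Finset.mem_univ, true_and,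
    Finset.mem_image, splitEdge, Prod.mk.injEq, Prod.exists]
  refine or_congr Iff.rfl ⟨?_, ?_⟩
  · rintro ⟨a, b, hab, ⟨rfl, rfl⟩, rfl, rfl⟩
    exact ⟨hab, rfl, rfl⟩
  · rintro ⟨h, rfl, rfl⟩
    exact ⟨u, v, h, ⟨rfl, rfl⟩, rfl, rfl⟩

theorem card_splitGraph_out_zero_le (φ : V ≃ Fin n) (E : Finset (V × V)) (u : V) :
    ((splitGraph φ E).filter fun e => e.1 = (u, 0)).card ≤ 1 := by
  rw [Finset.card_le_one]
  rintro ⟨⟨a, i⟩, ⟨b, j⟩⟩ h ⟨⟨a', i'⟩, ⟨b', j'⟩⟩ h'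
  simp only [Finset.mem_filter, mem_splitGraph, Prod.mk.injEq] at h h'
  obtain ⟨h, rfl, rfl⟩ := h
  obtain ⟨h', rfl, rfl⟩ := h'
  have hφ : ∀ x, (0 : Fin (n + 1)) ≠ (φ x).succ := fun x => (Fin.succ_ne_zero _).symm
  simp only [hφ, false_and, and_false, or_false] at h h'
  obtain ⟨rfl, hj⟩ := h
  obtain ⟨rfl, hj'⟩ := h'
  rw [Fin.ext (hj.trans hj'.symm)]

theorem card_splitGraph_out_le (φ : V ≃ Fin n) (E : Finset (V × V)) (x : V × Fin (n + 1)) :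
    ((splitGraph φ E).filter fun e => e.1 = x).card ≤ 2 := by
  rw [← Finset.card_filter_add_card_filter_not (fun e => e.2.2 = 0)]
  refine Nat.add_le_add (b := 1) (d := 1) ?_ ?_ <;>
  · rw [Finset.card_le_one]
    rintro ⟨⟨a, i⟩, ⟨b, j⟩⟩ h ⟨⟨a', i'⟩, ⟨b', j'⟩⟩ h'
    simp only [Finset.mem_filter, mem_splitGraph] at h h'
    obtain ⟨⟨h, rfl⟩, hj⟩ := h
    obtain ⟨⟨h', h_eq⟩, hj'⟩ := h'
    obtain ⟨rfl, rfl⟩ := Prod.mk.inj h_eq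
    first
    | subst hj hj'
      simp only [Fin.val_zero, Nat.right_eq_add, Nat.add_eq_zero_iff, one_ne_zero, and_false,
        false_or, and_true] at h h'
      have : b = b' := φ.injective (Fin.succ_injective _ (h.2.symm.trans h'.2))
      rw [this]
    | simp only [hj, hj', and_false, or_false] at h h'
      obtain ⟨rfl, h⟩ := h
      obtain ⟨rfl, h'⟩ := h'
      rw [Fin.ext (h.trans h'.symm)]

/-- Reachability passes from `E` to the split graph. -/
theorem DReach.split (φ : V ≃ Fin n) {E F : Finset (V × V)} {s v : V}
    (h : DReach ((E : Set (V × V)) \ F) s v) :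
    DReach ((splitGraph φ E : Set _) \ (F.image (splitEdge φ) : Finset _))
      (s, (0 : Fin (n + 1))) (v, 0) := by
  have hlink : ∀ (u : V) (m : ℕ) (hm : m < n + 1),
      DReach ((splitGraph φ E : Set _) \ (F.image (splitEdge φ) : Finset _))
        (u, (0 : Fin (n + 1))) (u, ⟨m, hm⟩) := by
    intro u m
    induction m with
    | zero => exact fun _ => .refl
    | succ m ih =>
      intro hm
      refine (ih (by omega)).tail ⟨?_, ?_⟩
      · rw [Finset.mem_coe, mem_splitGraph]
        exact Or.inl ⟨rfl, rfl⟩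
      · simp [splitEdge, Fin.ext_iff]
  induction h with
  | refl => exact .refl
  | @tail b c _ hbc ih =>
    refine (ih.trans (hlink b _ (φ c).succ.isLt)).tail ⟨?_, ?_⟩
    · rw [Finset.mem_coe, mem_splitGraph]
      exact Or.inr ⟨hbc.1, rfl, rfl⟩
    · intro h
      rw [Finset.mem_coe, Finset.mem_image] at h
      obtain ⟨e, he, heq⟩ := h
      have := splitEdge_injective φ (a₂ := (b, c)) heq
      exact hbc.2 (this ▸ he)

/-- Reachability in a subgraph of the split graph projects to the original graph. -/
theorem DReach.of_split (φ : V ≃ Fin n) {E F : Finset (V × V)}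
    {H : Finset ((V × Fin (n + 1)) × (V × Fin (n + 1)))} (hH : H ⊆ splitGraph φ E)
    {x y : V × Fin (n + 1)}
    (h : DReach ((H : Set _) \ (F.image (splitEdge φ) : Finset _)) x y) :
    DReach (((E.filter fun e => splitEdge φ e ∈ H : Finset _) : Set (V × V)) \ F) x.1 y.1 := by
  induction h with
  | refl => exact .refl
  | @tail b c _ hbc ih =>
    obtain ⟨u, i⟩ := b
    obtain ⟨v, j⟩ := c
    obtain ⟨h1, h2⟩ := hbc
    rcases mem_splitGraph.1 (hH h1) with ⟨rfl, -⟩ | ⟨hE, rfl, rfl⟩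
    · exact ih
    · refine ih.tail ⟨?_, fun hF => h2 ?_⟩
      · simpa using ⟨hE, h1⟩
      · exact Finset.mem_coe.2 (Finset.mem_image.2 ⟨(u, v), hF, rfl⟩)

/-- The in-edges of a vertex `t` can be thinned out to `2 ^ k` edges while preserving reachability
of `t` under `k` faults. -/
theorem exists_thinned (k : ℕ) (E : Finset (V × V)) (s t : V) :
    ∃ H ⊆ E, (∀ e ∈ E, e.2 ≠ t → e ∈ H) ∧ (H.filter fun e => e.2 = t).card ≤ 2 ^ k ∧
      ∀ F : Finset (V × V), F.card ≤ k →
        DReach ((E : Set (V × V)) \ F) s t → DReach ((H : Set (V × V)) \ F) s t := by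
  by_cases hst : s = t
  · subst hst
    refine ⟨E.filter fun e => e.2 ≠ s, Finset.filter_subset _ _, by simp +contextual, ?_,
      fun _ _ _ => .refl⟩
    simp [Finset.filter_filter]
  · let φ := Fintype.equivFin V
    obtain ⟨H, hHD, hkeep, hcard, hreach⟩ := exists_thinned_of_outdegree_le_two
      (D := splitGraph φ E) (s := (s, 0)) (t := (t, 0)) (by simpa using hst)
      (card_splitGraph_out_zero_le φ E s) (card_splitGraph_out_le φ E) k
    refine ⟨E.filter fun e => splitEdge φ e ∈ H, Finset.filter_subset _ _, fun e he het => ?_, ?_,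
      fun F hF h => ?_⟩
    · refine Finset.mem_filter.2 ⟨he, hkeep _ ?_ (by simpa [splitEdge] using het)⟩
      exact Finset.mem_union_right _ (Finset.mem_image_of_mem _ he)
    · refine (Finset.card_le_card_of_injOn (splitEdge φ) (fun e he => ?_)
        (splitEdge_injective φ).injOn).trans hcard
      simp only [Finset.coe_filter, Finset.mem_filter, Set.mem_ofPred_eq] at he ⊢
      exact ⟨he.1.2, by simp [splitEdge, he.2]⟩
    · exact DReach.of_split φ hHD
        (hreach _ (Finset.card_image_le.trans hF) (DReach.split φ h))

end Splitting

/-- If only in-edges of `t` are removed and `t` stays reachable, then all reachable vertices stay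
reachable. -/
theorem DReach.of_thinned {V : Type*} {E H : Set (V × V)} {s t v : V}
    (hkeep : ∀ e ∈ E, e.2 ≠ t → e ∈ H) (ht : DReach E s t → DReach H s t)
    (h : DReach E s v) : DReach H s v := by
  induction h with
  | refl => exact .refl
  | @tail b c hab hbc ih =>
    by_cases hc : c = t
    · subst hc
      exact ht (hab.tail hbc)
    · exact ih.tail (hkeep _ hbc hc)

theorem DReach.mono {V : Type*} {E H : Set (V × V)} (hEH : E ⊆ H) {s v : V}
    (h : DReach E s v) : DReach H s v :=
  Relation.ReflTransGen.mono (fun _ _ hab => hEH hab) _ _ h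

theorem exists_thinned_on {V : Type*} [Fintype V] [DecidableEq V] (k : ℕ)
    (E : Finset (V × V)) (s : V) (T : Finset V) :
    ∃ H ⊆ E, (∀ v ∈ T, (H.filter fun e => e.2 = v).card ≤ 2 ^ k) ∧
      ∀ F : Finset (V × V), F.card ≤ k → ∀ v,
        DReach ((E : Set (V × V)) \ F) s v → DReach ((H : Set (V × V)) \ F) s v := by
  induction T using Finset.induction_on with
  | empty => exact ⟨E, subset_rfl, by simp, fun _ _ _ h => h⟩
  | insert t T _ ih =>
    obtain ⟨H, hHE, hdeg, hH⟩ := ih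
    obtain ⟨H', hHH, hkeep, hcard, hH'⟩ := exists_thinned k H s t
    refine ⟨H', hHH.trans hHE, fun v hv => ?_, fun F hF v h => ?_⟩
    · rcases Finset.mem_insert.1 hv with rfl | hv
      · exact hcard
      · exact (Finset.card_le_card (Finset.filter_subset_filter _ hHH)).trans (hdeg v hv)
    · exact (hH F hF v h).of_thinned (fun e he het => ⟨hkeep e he.1 het, he.2⟩) (hH' F hF)

/-- Theorem 2 of the paper. For every `k ≥ 1`, every directed
graph `G` on a finite vertex set `V`, and every source `s ∈ V`, there exists a
subgraph `H` of `G` such that every vertex has in-degree at most `2^k` in `H`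
(hence `H` has at most `2^k·|V|` edges), and `H` is a `k`-FTRS of `G` w.r.t. `s`. -/
theorem exists_sparse_kftrs {V : Type*} [Fintype V] [DecidableEq V]
    (k : ℕ) (hk : 1 ≤ k) (E : Finset (V × V)) (s : V) :
    ∃ H : Finset (V × V), H ⊆ E ∧
      (∀ v : V, (H.filter (fun e => e.2 = v)).card ≤ 2 ^ k) ∧
      H.card ≤ 2 ^ k * Fintype.card V ∧
      IsKFTRS k ↑E ↑H s := by
  obtain ⟨H, hHE, hdeg, hH⟩ := exists_thinned_on k E s Finset.univ
  refine ⟨H, hHE, fun v => hdeg v (Finset.mem_univ v), ?_, Finset.coe_subset.2 hHE,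
    fun F _ hF v => ⟨hH F hF v, DReach.mono (Set.sdiff_subset_sdiff_left (by simpa using hHE))⟩⟩
  exact Finset.card_le_mul_card_image_of_maps_to (f := Prod.snd)
    (fun _ _ => Finset.mem_univ _) _ hdeg
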